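/- arXiv:2410.22915 — 4 statements merged into one kernel-verified Lean document; each statement's English description precedes it below -/
import Mathlib

section
/- For every n ≥ 2 and every real number t, the determinant of the Lorentz product of the Fibonacci–Hessenberg matrices E_{n,t} and F_{n,t} equals det(E_{n,t} ·_L F_{n,t}) = −F_{2n−2}F_{n+1}·t² − (F_{2n−2}F_{n} + F_{2n−1}F_{n+1})·t − F_{2n−1}F_{n}. -/
/-- The n×n Lorentz signature matrix J = diag(-1,1,...,1). -/
def lorentzJ (n : ℕ) : Matrix (Fin n) (Fin n) ℝ :=
  Matrix.diagonal fun j => if (j : ℕ) = 0 then -1 else 1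

/-- The Lorentz matrix product: (A ·_L B) i k = -a_{i1} b_{1k} + ∑_{j≥2} a_{ij} b_{jk},
equivalently A · J · B. -/
def lorentzMul {m n p : ℕ} (A : Matrix (Fin m) (Fin n) ℝ) (B : Matrix (Fin n) (Fin p) ℝ) :
    Matrix (Fin m) (Fin p) ℝ :=
  A * lorentzJ n * B

/-- Fibonacci-Hessenberg matrix E_{n,t} -/
def Emat (n : ℕ) (t : ℝ) : Matrix (Fin n) (Fin n) ℝ :=
  Matrix.of fun i j =>
    if (i : ℕ) + 1 < (j : ℕ) then 0
    else if (j : ℕ) = (i : ℕ) + 1 then -1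
    else if (i : ℕ) = (j : ℕ) then (if (i : ℕ) + 1 = n then t + 1 else if (i : ℕ) = 0 then 1 else 2)
    else 1

/-- Fibonacci-Hessenberg matrix F_{n,t} -/
def Fmat (n : ℕ) (t : ℝ) : Matrix (Fin n) (Fin n) ℝ :=
  Matrix.of fun i j =>
    if (i : ℕ) + 1 < (j : ℕ) then 0
    else if (j : ℕ) = (i : ℕ) + 1 then -1
    else if (i : ℕ) = (j : ℕ) then (if (i : ℕ) + 1 = n then t + 1 else 2)
    else (-1 : ℝ) ^ ((i : ℕ) + (j : ℕ))

/-- A lower Hessenberg matrix with superdiagonal entries `-1` has as its determinant the last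
entry of its product with the vector `u` that it maps to a multiple of the last basis vector. -/
theorem det_of_lowerHessenberg (m : ℕ) (l : ℕ → ℕ → ℝ) (u : ℕ → ℝ) (hu : u 0 = 1)
    (hl : ∀ i < m, ∑ j ∈ Finset.range (i + 1), l i j * u j = u (i + 1)) :
    (Matrix.of fun i j : Fin (m + 1) =>
      if (i : ℕ) + 1 < (j : ℕ) then 0
      else if (j : ℕ) = (i : ℕ) + 1 then -1
      else l i j).det = ∑ j ∈ Finset.range (m + 1), l m j * u j := by
  set A : Matrix (Fin (m + 1)) (Fin (m + 1)) ℝ := Matrix.of fun i j =>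
      if (i : ℕ) + 1 < (j : ℕ) then 0
      else if (j : ℕ) = (i : ℕ) + 1 then -1
      else l i j with hA
  set c := ∑ j ∈ Finset.range (m + 1), l m j * u j
  have hrow (i : Fin (m + 1)) : (A.mulVec fun j => u j) i = ∑ j ∈ Finset.range (m + 1),
      (if (i : ℕ) + 1 < j then 0 else if j = (i : ℕ) + 1 then -1 else l i j) * u j := by
    rw [← Fin.sum_univ_eq_sum_range
      (fun j => (if (i : ℕ) + 1 < j then 0 else if j = (i : ℕ) + 1 then -1 else l i j) * u j)]
    rfl
  have hbelow (i k : ℕ) (hk : k ≤ i + 1) : ∑ j ∈ Finset.range k,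
      (if i + 1 < j then 0 else if j = i + 1 then -1 else l i j) * u j
        = ∑ j ∈ Finset.range k, l i j * u j := by
    refine Finset.sum_congr rfl fun j hj => ?_
    have := Finset.mem_range.1 hj
    rw [if_neg (by omega), if_neg (by omega)]
  have hmul : (A.mulVec fun j => u j) = Pi.single (Fin.last m) c := by
    ext i
    rw [hrow]
    rcases Fin.eq_castSucc_or_eq_last i with ⟨k, rfl⟩ | rfl
    · rw [Pi.single_eq_of_ne (Fin.castSucc_lt_last k).ne, Fin.val_castSucc]
      rw [← Finset.sum_subset (s₁ := Finset.range (k + 2))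
        (Finset.range_subset_range.2 (by omega)), Finset.sum_range_succ, hbelow _ _ le_rfl,
        hl k k.isLt]
      · simp
      · intro j _ hj
        rw [Finset.mem_range] at hj
        rcases lt_or_ge ((k : ℕ) + 1) j with h | h
        · simp [h]
        · omega
    · rw [Pi.single_eq_same, Fin.val_last, hbelow _ _ le_rfl]
  have hminor : (A.submatrix (Fin.last m).succAbove (Fin.succAbove 0)).det = (-1) ^ m := by
    rw [Matrix.det_of_isLowerTriangular]
    · simp [hA]
    · intro i j hij
      have : (i : ℕ) < j := hij
      simp [hA, this]
  have hadj := congrFun (congrArg A.adjugate.mulVec hmul) 0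
  rw [Matrix.mulVec_mulVec, Matrix.adjugate_mul, Matrix.smul_mulVec, Matrix.one_mulVec,
    Matrix.mulVec_single] at hadj
  simp only [Pi.smul_apply, Matrix.col_apply, Matrix.adjugate_fin_succ_eq_det_submatrix, hminor,
    Fin.val_zero, Fin.val_last, hu, smul_eq_mul, MulOpposite.smul_eq_mul_unop,
    MulOpposite.unop_op, mul_one, add_zero, ← mul_pow, neg_mul_neg, one_pow, one_mul] at hadj
  exact hadj

theorem sum_range_succ_fib_two_mul (i : ℕ) :
    ∑ j ∈ Finset.range (i + 1), (if j = 0 then (1 : ℝ) else Nat.fib (2 * j))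
      = Nat.fib (2 * i + 1) := by
  induction i with
  | zero => simp
  | succ i ih =>
    rw [Finset.sum_range_succ, ih, if_neg (by omega), show 2 * (i + 1) + 1 = 2 * i + 1 + 2 by ring,
      Nat.fib_add_two (n := 2 * i + 1)]
    push_cast
    rfl

theorem sum_range_neg_one_pow_mul_fib (i : ℕ) :
    ∑ j ∈ Finset.range i, (-1 : ℝ) ^ (i + j) * Nat.fib (j + 2) = -Nat.fib i := by
  induction i with
  | zero => simp
  | succ i ih =>
    have hsign (j : ℕ) : (-1 : ℝ) ^ (i + 1 + j) * Nat.fib (j + 2)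
        = -((-1 : ℝ) ^ (i + j) * Nat.fib (j + 2)) := by ring
    simp_rw [hsign]
    rw [Finset.sum_neg_distrib, Finset.sum_range_succ, ih, ← two_mul, pow_mul, Nat.fib_add_two]
    push_cast
    norm_num

theorem det_Emat (m : ℕ) (hm : 1 ≤ m) (t : ℝ) :
    (Emat (m + 1) t).det = Nat.fib (2 * m) * t + Nat.fib (2 * m + 1) := by
  have hsum (i : ℕ) (d : ℝ) : ∑ j ∈ Finset.range (i + 1), (if i = j then d + 1 else 1) *
      (if j = 0 then (1 : ℝ) else Nat.fib (2 * j))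
        = d * (if i = 0 then (1 : ℝ) else Nat.fib (2 * i)) + Nat.fib (2 * i + 1) := by
    rw [← sum_range_succ_fib_two_mul, Finset.sum_range_succ, Finset.sum_range_succ, if_pos rfl]
    have hlt : ∀ j ∈ Finset.range i, (if i = j then d + 1 else 1) *
        (if j = 0 then (1 : ℝ) else Nat.fib (2 * j)) = if j = 0 then (1 : ℝ) else Nat.fib (2 * j) := by
      intro j hj
      rw [if_neg (Finset.mem_range.1 hj).ne', one_mul]
    rw [Finset.sum_congr rfl hlt]
    ring
  refine (det_of_lowerHessenberg m
    (fun i j => if i = j then (if i + 1 = m + 1 then t + 1 else if i = 0 then 1 else 2) else 1)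
    (fun j => if j = 0 then 1 else Nat.fib (2 * j)) (by simp) ?_).trans ?_
  · intro i hi
    have hd : (if i + 1 = m + 1 then t + 1 else if i = 0 then 1 else 2)
        = (if i = 0 then (0 : ℝ) else 1) + 1 := by
      rw [if_neg (by omega)]
      split_ifs <;> norm_num
    simp only [hd, hsum, if_neg i.succ_ne_zero]
    rcases eq_or_ne i 0 with rfl | hi0
    · simp
    · rw [if_neg hi0, if_neg hi0, mul_add_one, Nat.fib_add_two]
      push_cast
      ring
  · simp only [if_true, hsum, if_neg (by omega : m ≠ 0)]
    ring

theorem det_Fmat (m : ℕ) (t : ℝ) :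
    (Fmat (m + 1) t).det = Nat.fib (m + 2) * t + Nat.fib (m + 1) := by
  have hsum (i : ℕ) (d : ℝ) : ∑ j ∈ Finset.range (i + 1),
      (if i = j then d else (-1) ^ (i + j)) * (Nat.fib (j + 2) : ℝ)
        = d * Nat.fib (i + 2) - Nat.fib i := by
    rw [Finset.sum_range_succ, if_pos rfl, add_comm, sub_eq_add_neg,
      ← sum_range_neg_one_pow_mul_fib]
    congr 1
    refine Finset.sum_congr rfl fun j hj => ?_
    rw [if_neg (Finset.mem_range.1 hj).ne']
  refine (det_of_lowerHessenberg m
    (fun i j => if i = j then (if i + 1 = m + 1 then t + 1 else 2) else (-1) ^ (i + j))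
    (fun j => Nat.fib (j + 2)) (by simp) ?_).trans ?_
  · intro i hi
    rw [hsum, if_neg (by omega), Nat.fib_add_two (n := i + 1), Nat.fib_add_two (n := i)]
    push_cast
    ring
  · rw [hsum, if_pos rfl, Nat.fib_add_two]
    push_cast
    ring

theorem det_lorentzJ (m : ℕ) : (lorentzJ (m + 1)).det = -1 := by
  simp [lorentzJ, Matrix.det_diagonal]

theorem det_lorentz_EF (n : ℕ) (hn : 2 ≤ n) (t : ℝ) :
    (lorentzMul (Emat n t) (Fmat n t)).det =
      -((Nat.fib (2 * n - 2) : ℝ) * (Nat.fib (n + 1) : ℝ)) * t ^ 2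
        - ((Nat.fib (2 * n - 2) : ℝ) * (Nat.fib n : ℝ)
            + (Nat.fib (2 * n - 1) : ℝ) * (Nat.fib (n + 1) : ℝ)) * t
        - (Nat.fib (2 * n - 1) : ℝ) * (Nat.fib n : ℝ) := by
  obtain ⟨m, rfl⟩ : ∃ m, n = m + 1 := ⟨n - 1, by omega⟩
  rw [lorentzMul, Matrix.det_mul, Matrix.det_mul, det_lorentzJ, det_Emat m (by omega), det_Fmat,
    show 2 * (m + 1) - 2 = 2 * m by omega, show 2 * (m + 1) - 1 = 2 * m + 1 by omega]
  ring
end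

section
/- For every n ≥ 2 and every real number t, the determinant of the Lorentz product of the Fibonacci–Hessenberg matrices G_{n,t} and H_{n,t} equals det(G_{n,t} ·_L H_{n,t}) = −F_{n−1}F_{2n−2}·t² − (F_{n−2}F_{2n−2} + F_{n−1}F_{2n−1})·t − F_{n−2}F_{2n−1}. -/
/-- Fibonacci-Hessenberg matrix G_{n,t} -/
def Gmat (n : ℕ) (t : ℝ) : Matrix (Fin n) (Fin n) ℝ :=
  Matrix.of fun i j =>
    if (i : ℕ) + 1 < (j : ℕ) then 0
    else if (j : ℕ) = (i : ℕ) + 1 then -1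
    else if (i : ℕ) = (j : ℕ) then (if (i : ℕ) + 1 = n then t + 1 else if (i : ℕ) = 0 then 1 else 2)
    else (-1 : ℝ) ^ ((i : ℕ) + (j : ℕ))

/-- Fibonacci-Hessenberg matrix H_{n,t} -/
def Hmat (n : ℕ) (t : ℝ) : Matrix (Fin n) (Fin n) ℝ :=
  Matrix.of fun i j =>
    if (i : ℕ) + 1 < (j : ℕ) then 0
    else if (j : ℕ) = (i : ℕ) + 1 then 1
    else if (i : ℕ) = (j : ℕ) then (if (i : ℕ) + 1 = n then t + 1 else if (i : ℕ) = 0 then 1 else 2)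
    else (-1 : ℝ) ^ ((i : ℕ) + (j : ℕ))

/-- The common shape of the Fibonacci-Hessenberg matrices, with constant superdiagonal `u`. -/
def fibHessenberg (u : ℝ) (n : ℕ) (t : ℝ) : Matrix (Fin n) (Fin n) ℝ :=
  Matrix.of fun i j =>
    if (i : ℕ) + 1 < (j : ℕ) then 0
    else if (j : ℕ) = (i : ℕ) + 1 then u
    else if (i : ℕ) = (j : ℕ) then (if (i : ℕ) + 1 = n then t + 1 else if (i : ℕ) = 0 then 1 else 2)
    else (-1 : ℝ) ^ ((i : ℕ) + (j : ℕ))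

theorem det_fibHessenberg_two (u t : ℝ) : (fibHessenberg u 2 t).det = t + 1 + u := by
  simp [Matrix.det_fin_two, fibHessenberg]

theorem fibHessenberg_submatrix_last (u : ℝ) (k : ℕ) (t : ℝ) :
    (fibHessenberg u (k + 3) t).submatrix Fin.castSucc Fin.castSucc =
      fibHessenberg u (k + 2) 1 := by
  ext i j
  have hi := i.isLt
  simp only [fibHessenberg, Matrix.submatrix_apply, Matrix.of_apply, Fin.val_castSucc]
  split_ifs <;> first | rfl | omega | norm_num

theorem fibHessenberg_submatrix_penultimate (u : ℝ) (k : ℕ) (t : ℝ) :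
    (fibHessenberg u (k + 3) t).submatrix (Fin.last (k + 1)).castSucc.succAbove Fin.castSucc =
      (fibHessenberg u (k + 2) 0).updateRow (Fin.last (k + 1))
        ((-1 : ℝ) • fibHessenberg u (k + 2) 0 (Fin.last (k + 1))) := by
  ext i j
  have hj := j.isLt
  induction i using Fin.lastCases with
  | last =>
    simp only [Matrix.updateRow_self, Matrix.submatrix_apply, Pi.smul_apply, smul_eq_mul,
      Fin.succAbove_castSucc_self, fibHessenberg, Matrix.of_apply, Fin.val_castSucc, Fin.val_succ,
      Fin.val_last]
    by_cases h : (j : ℕ) = k + 1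
    · have hodd : (-1 : ℝ) ^ (k + 1 + 1 + (k + 1)) = -1 := Odd.neg_one_pow ⟨k + 1, by ring⟩
      simp [h, hodd, show k ≤ k + 1 + 1 by omega]
    · simp (disch := omega) only [if_neg]
      ring
  | cast i =>
    have hi := i.isLt
    rw [Matrix.updateRow_ne (Fin.castSucc_lt_last i).ne]
    have h : (Fin.last (k + 1)).castSucc.succAbove i.castSucc = i.castSucc.castSucc :=
      Fin.succAbove_of_castSucc_lt _ _ (by simp only [Fin.lt_def, Fin.val_castSucc, Fin.val_last]; omega)
    simp only [Matrix.submatrix_apply, h, fibHessenberg, Matrix.of_apply, Fin.val_castSucc]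
    split_ifs <;> first | rfl | omega

theorem det_fibHessenberg_succ (u : ℝ) (k : ℕ) (t : ℝ) :
    (fibHessenberg u (k + 3) t).det =
      (t + 1) * (fibHessenberg u (k + 2) 1).det + u * (fibHessenberg u (k + 2) 0).det := by
  have hlast : fibHessenberg u (k + 3) t (Fin.last _) (Fin.last _) = t + 1 := by
    simp [fibHessenberg]
  have hpen : fibHessenberg u (k + 3) t (Fin.last (k + 1)).castSucc (Fin.last _) = u := by
    simp [fibHessenberg]
  have hzero (i : Fin (k + 1)) :
      fibHessenberg u (k + 3) t i.castSucc.castSucc (Fin.last _) = 0 := by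
    simp only [fibHessenberg, Matrix.of_apply, Fin.val_castSucc, Fin.val_last]
    rw [if_pos (by omega)]
  rw [Matrix.det_succ_column _ (Fin.last _), Fin.sum_univ_castSucc, Fin.sum_univ_castSucc]
  simp only [hlast, hpen, hzero, Fin.succAbove_last, fibHessenberg_submatrix_last,
    fibHessenberg_submatrix_penultimate, Matrix.det_updateRow_smul, Matrix.updateRow_eq_self,
    mul_zero, zero_mul, Finset.sum_const_zero, Fin.val_last, Fin.val_castSucc]
  have hodd : (-1 : ℝ) ^ (k + 1 + (k + 2)) = -1 := Odd.neg_one_pow ⟨k + 1, by ring⟩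
  have heven : (-1 : ℝ) ^ (k + 2 + (k + 2)) = 1 := Even.neg_one_pow ⟨k + 2, rfl⟩
  rw [hodd, heven]
  ring

theorem det_Gmat (k : ℕ) (t : ℝ) :
    (Gmat (k + 2) t).det = Nat.fib (k + 1) * t + Nat.fib k := by
  change (fibHessenberg (-1) (k + 2) t).det = _
  induction k generalizing t with
  | zero => simp [det_fibHessenberg_two]
  | succ k ih =>
    rw [det_fibHessenberg_succ, ih, ih, Nat.fib_add_two (n := k)]
    push_cast
    ring

theorem det_Hmat (k : ℕ) (t : ℝ) :
    (Hmat (k + 2) t).det = Nat.fib (2 * k + 2) * t + Nat.fib (2 * k + 3) := by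
  change (fibHessenberg 1 (k + 2) t).det = _
  induction k generalizing t with
  | zero => rw [det_fibHessenberg_two]; norm_num [Nat.fib_add_two]; ring
  | succ k ih =>
    rw [det_fibHessenberg_succ, ih, ih, show 2 * (k + 1) + 3 = 2 * k + 3 + 2 by ring,
      show 2 * (k + 1) + 2 = 2 * k + 2 + 2 by ring, Nat.fib_add_two (n := 2 * k + 3),
      Nat.fib_add_two (n := 2 * k + 2)]
    push_cast
    ring

theorem det_lorentzJ_succ (n : ℕ) : (lorentzJ (n + 1)).det = -1 := by
  simp [lorentzJ, Matrix.det_diagonal]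

theorem det_lorentz_GH (n : ℕ) (hn : 2 ≤ n) (t : ℝ) :
    (lorentzMul (Gmat n t) (Hmat n t)).det =
      -((Nat.fib (n - 1) : ℝ) * (Nat.fib (2 * n - 2) : ℝ)) * t ^ 2
        - ((Nat.fib (n - 2) : ℝ) * (Nat.fib (2 * n - 2) : ℝ)
            + (Nat.fib (n - 1) : ℝ) * (Nat.fib (2 * n - 1) : ℝ)) * t
        - (Nat.fib (n - 2) : ℝ) * (Nat.fib (2 * n - 1) : ℝ) := by
  obtain ⟨k, rfl⟩ := Nat.exists_eq_add_of_le' hn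
  rw [lorentzMul, Matrix.det_mul, Matrix.det_mul, det_Gmat, det_Hmat, det_lorentzJ_succ,
    show k + 2 - 1 = k + 1 by omega, show k + 2 - 2 = k by omega,
    show 2 * (k + 2) - 2 = 2 * k + 2 by omega, show 2 * (k + 2) - 1 = 2 * k + 3 by omega]
  ring
end

section
/- For every n ≥ 1 and every real number t, the determinant of the Fibonacci–Hessenberg matrix C_{n,t} equals det C_{n,t} = F_{n+1}·t + F_{n}. -/
/-- Fibonacci-Hessenberg matrix C_{n,t} -/
def Cmat (n : ℕ) (t : ℝ) : Matrix (Fin n) (Fin n) ℝ :=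
  Matrix.of fun i j =>
    if (i : ℕ) + 1 < (j : ℕ) then 0
    else if (j : ℕ) = (i : ℕ) + 1 then 1
    else if (i : ℕ) = (j : ℕ) then (if (i : ℕ) + 1 = n then t + 1 else 2)
    else 1

theorem Matrix.det_succ_row_zero_of_eq_zero {R : Type*} [CommRing R] {n : ℕ}
    (A : Matrix (Fin (n + 2)) (Fin (n + 2)) R) (h : ∀ j : Fin n, A 0 j.succ.succ = 0) :
    A.det = A 0 0 * (A.submatrix Fin.succ Fin.succ).det
      - A 0 1 * (A.submatrix Fin.succ (Fin.succAbove 1)).det := by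
  rw [Matrix.det_succ_row_zero, Fin.sum_univ_succ, Fin.sum_univ_succ]
  simp [h, sub_eq_add_neg]

theorem Cmat_submatrix_succ (n : ℕ) (t : ℝ) :
    (Cmat (n + 1) t).submatrix Fin.succ Fin.succ = Cmat n t := by
  ext i j
  simp [Cmat]

theorem Cmat_submatrix_succAbove_one (n : ℕ) (t : ℝ) :
    (Cmat (n + 2) t).submatrix Fin.succ (Fin.succAbove 1)
      = (Cmat (n + 1) t).updateCol 0 1 := by
  ext i j
  cases j using Fin.cases with
  | zero => simp [Cmat]
  | succ j => simp [Cmat, Fin.one_succAbove_succ]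

theorem det_Cmat_add_two (n : ℕ) (t : ℝ) :
    (Cmat (n + 2) t).det
      = 2 * (Cmat (n + 1) t).det - ((Cmat (n + 1) t).updateCol 0 1).det := by
  rw [Matrix.det_succ_row_zero_of_eq_zero _ fun j => by simp [Cmat],
    Cmat_submatrix_succ, Cmat_submatrix_succAbove_one]
  simp [Cmat]

theorem det_updateCol_Cmat_add_two (n : ℕ) (t : ℝ) :
    ((Cmat (n + 2) t).updateCol 0 1).det
      = (Cmat (n + 1) t).det - ((Cmat (n + 1) t).updateCol 0 1).det := by
  have h₁ : ((Cmat (n + 2) t).updateCol 0 1).submatrix Fin.succ Fin.succ = Cmat (n + 1) t := by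
    rw [← Cmat_submatrix_succ (n + 1)]
    ext i j
    simp
  have h₂ : ((Cmat (n + 2) t).updateCol 0 1).submatrix Fin.succ (Fin.succAbove 1)
      = (Cmat (n + 1) t).updateCol 0 1 := by
    rw [← Cmat_submatrix_succAbove_one n]
    ext i j
    cases j using Fin.cases with
    | zero => simp [Cmat]
    | succ j => simp [Cmat, Fin.one_succAbove_succ]
  rw [Matrix.det_succ_row_zero_of_eq_zero _ fun j => by simp [Cmat], h₁, h₂]
  simp [Cmat]

theorem det_Cmat_and_det_updateCol_Cmat (n : ℕ) (t : ℝ) :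
    (Cmat (n + 1) t).det = (Nat.fib (n + 2) : ℝ) * t + (Nat.fib (n + 1) : ℝ) ∧
    ((Cmat (n + 1) t).updateCol 0 1).det
      = (Nat.fib n : ℝ) * t + ((Nat.fib (n + 1) : ℝ) - (Nat.fib n : ℝ)) := by
  induction n with
  | zero => simp [Cmat]
  | succ n ih =>
    rw [det_Cmat_add_two, det_updateCol_Cmat_add_two, ih.1, ih.2]
    simp only [Nat.fib_add_two, Nat.cast_add]
    constructor <;> ring

theorem det_Cmat (n : ℕ) (hn : 1 ≤ n) (t : ℝ) :
    (Cmat n t).det = (Nat.fib (n + 1) : ℝ) * t + (Nat.fib n : ℝ) := by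
  obtain ⟨m, rfl⟩ := Nat.exists_eq_add_of_le' hn
  exact (det_Cmat_and_det_updateCol_Cmat m t).1
end

section
/- For every n ≥ 1 and every real number t, the determinant of the Fibonacci–Hessenberg matrix D_{n,t} equals det D_{n,t} = F_{2n−1}·t + F_{2n}. -/
/-- Fibonacci-Hessenberg matrix D_{n,t} -/
def Dmat (n : ℕ) (t : ℝ) : Matrix (Fin n) (Fin n) ℝ :=
  Matrix.of fun i j =>
    if (i : ℕ) + 1 < (j : ℕ) then 0
    else if (j : ℕ) = (i : ℕ) + 1 then -1
    else if (i : ℕ) = (j : ℕ) then (if (i : ℕ) + 1 = n then t + 1 else 2)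
    else 1

/-- Laplace expansion along the first row, for `Dmat` with its first column replaced by
`(a, 1, …, 1)`. -/
theorem det_Dmat_updateCol_cons (n : ℕ) (t a : ℝ) :
    ((Dmat (n + 2) t).updateCol 0 (Fin.cons a fun _ => 1)).det =
      a * (Dmat (n + 1) t).det + ((Dmat (n + 1) t).updateCol 0 fun _ => 1).det := by
  have h₀ : ((Dmat (n + 2) t).updateCol 0 (Fin.cons a fun _ => 1)).submatrix Fin.succ
      (Fin.succAbove 0) = Dmat (n + 1) t := by
    ext i j
    simp [Dmat]
  have h₁ : ((Dmat (n + 2) t).updateCol 0 (Fin.cons a fun _ => 1)).submatrix Fin.succ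
      (Fin.succAbove (Fin.succ 0)) = (Dmat (n + 1) t).updateCol 0 fun _ => 1 := by
    ext i j
    refine Fin.cases ?_ (fun j => ?_) j
    · simp
    · simp [Dmat]
  rw [Matrix.det_succ_row_zero, Fin.sum_univ_succ, Fin.sum_univ_succ, h₀, h₁,
    Finset.sum_eq_zero]
  · simp [Dmat]
  · intro j _
    simp [Dmat]

theorem Dmat_eq_updateCol_cons (n : ℕ) (t : ℝ) :
    Dmat (n + 2) t = (Dmat (n + 2) t).updateCol 0 (Fin.cons 2 fun _ => 1) := by
  ext i j
  refine Fin.cases ?_ (fun j => ?_) j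
  · refine Fin.cases ?_ (fun i => ?_) i <;> simp [Dmat]
  · simp

theorem det_Dmat_succ_and_det_updateCol_one (n : ℕ) (t : ℝ) :
    (Dmat (n + 1) t).det = (Nat.fib (2 * n + 1) : ℝ) * t + (Nat.fib (2 * n + 2) : ℝ) ∧
      ((Dmat (n + 1) t).updateCol 0 fun _ => 1).det =
        (Nat.fib (2 * n) : ℝ) * t + (Nat.fib (2 * n + 1) : ℝ) := by
  induction n with
  | zero => simp [Dmat]
  | succ n ih =>
    obtain ⟨hd, hu⟩ := ih
    have h_cons : (fun _ => 1 : Fin (n + 2) → ℝ) = Fin.cons 1 fun _ => 1 := by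
      ext i
      refine Fin.cases ?_ (fun i => ?_) i <;> simp
    have h₂ : (Nat.fib (2 * n + 2) : ℝ) = Nat.fib (2 * n) + Nat.fib (2 * n + 1) := by
      exact_mod_cast Nat.fib_add_two
    have h₃ : (Nat.fib (2 * n + 3) : ℝ) = Nat.fib (2 * n + 1) + Nat.fib (2 * n + 2) := by
      exact_mod_cast Nat.fib_add_two
    have h₄ : (Nat.fib (2 * n + 4) : ℝ) = Nat.fib (2 * n + 2) + Nat.fib (2 * n + 3) := by
      exact_mod_cast Nat.fib_add_two
    constructor
    · rw [Dmat_eq_updateCol_cons, det_Dmat_updateCol_cons, hd, hu,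
        show 2 * (n + 1) + 1 = 2 * n + 3 by ring, show 2 * (n + 1) + 2 = 2 * n + 4 by ring,
        h₄, h₃, h₂]
      ring
    · rw [h_cons, det_Dmat_updateCol_cons, hd, hu,
        show 2 * (n + 1) + 1 = 2 * n + 3 by ring, show 2 * (n + 1) = 2 * n + 2 by ring,
        h₃, h₂]
      ring

theorem det_Dmat (n : ℕ) (hn : 1 ≤ n) (t : ℝ) :
    (Dmat n t).det = (Nat.fib (2 * n - 1) : ℝ) * t + (Nat.fib (2 * n) : ℝ) := by
  obtain ⟨m, rfl⟩ := Nat.exists_eq_add_of_le' hn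
  exact (det_Dmat_succ_and_det_updateCol_one m t).1
end
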